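/- arXiv:1604.05392 — 4 statements merged into one kernel-verified Lean document; each statement's English description precedes it below -/
import Mathlib

section
/- Let (M, H) be a contact manifold and V a smooth vector bundle on M. A partial connection ∇_H on V uniquely determines a full connection ∇ on V with the following two properties: (i) the composition V → Λ¹⊗V → Λ¹_H⊗V of ∇ with the projection agrees with ∇_H, and (ii) the composition V →(∇) Λ¹⊗V →(∇_H) Λ²_H⊗V →(𝓛⁻¹⊗Id) L⊗V vanishes, where 𝓛⁻¹ : Λ²_H → L is the inverse of the nondegenerate Levi form on its range, and ∇_H : Λ¹⊗V → Λ²_H⊗V is the operator characterised by ∇_H(ω⊗σ) = d_Hω⊗σ − ω_H∧∇_Hσ. -/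
set_option maxSynthPendingDepth 5

noncomputable section

/-- The model space `ℝ^m` (our manifolds are open subsets `U ⊆ E m`). -/
abbrev E (m : ℕ) : Type := EuclideanSpace ℝ (Fin m)

/-- Covectors: the fibre of the cotangent bundle `Λ¹`. A 1-form is a map `E m → Cov m`. -/
abbrev Cov (m : ℕ) : Type := E m →L[ℝ] ℝ

/-- Smooth functions on `U` (with values in a normed space). -/
abbrev SmoothOnD {m : ℕ} {F : Type*} [NormedAddCommGroup F] [NormedSpace ℝ F]
    (f : E m → F) (U : Set (E m)) : Prop :=
  ContDiffOn ℝ (⊤ : ℕ∞) f U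

/-- The exterior derivative of a 1-form, via the Fréchet derivative. -/
def extDer {m : ℕ} (α : E m → Cov m) (x u v : E m) : ℝ :=
  fderiv ℝ α x u v - fderiv ℝ α x v u

/-- `θ` is a contact form on `U`: smooth, nowhere vanishing, and the Levi form of
`H = ker θ` (i.e. `dθ` restricted to `H`) is nondegenerate. -/
def IsContactForm {m : ℕ} (U : Set (E m)) (θ : E m → Cov m) : Prop :=
  SmoothOnD θ U ∧ ∀ x ∈ U, θ x ≠ 0 ∧
    ∀ v, θ x v = 0 → (∀ w, θ x w = 0 → extDer θ x v w = 0) → v = 0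

/-- `T` is the Reeb vector field of the contact form `θ` on `U`:
`θ(T) = 1` and `T ⌟ dθ = 0`. -/
def IsReebField {m : ℕ} (U : Set (E m)) (θ : E m → Cov m) (T : E m → E m) : Prop :=
  ∀ x ∈ U, θ x (T x) = 1 ∧ ∀ v, extDer θ x (T x) v = 0

/-- Christoffel symbols of a (partial) connection on the cotangent bundle, in the global
trivialisation of `T*(E m)`: every (partial) connection on `Λ¹` over `U ⊆ E m` is of the
form `∇_v σ (x) = (fderiv σ x) v + Γ x v (σ x)`. For a *partial* connection only the
values with `v ∈ H x` are relevant. -/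
abbrev Christoffel (m : ℕ) : Type := E m → E m →L[ℝ] Cov m →L[ℝ] Cov m

/-- The covariant derivative (in direction `v` at `x`) of the 1-form `σ`, for the
(partial) connection with Christoffel symbol `Γ`. -/
def covD {m : ℕ} (Γ : Christoffel m) (σ : E m → Cov m) (x v : E m) : Cov m :=
  fderiv ℝ σ x v + Γ x v (σ x)

/-- The partial connection `Γ` on `Λ¹` is free from partial torsion on `U`: the partial
torsion is the difference between `d_H : Λ¹ → Λ²_H` and
`Λ¹ → Λ¹_H ⊗ Λ¹ → Λ¹_H ⊗ Λ¹_H → Λ²_H`; here evaluated on `u, v ∈ H x = ker (θ x)`. -/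
def TorsionFreeOnH {m : ℕ} (U : Set (E m)) (θ : E m → Cov m) (Γ : Christoffel m) : Prop :=
  ∀ σ : E m → Cov m, SmoothOnD σ U → ∀ x ∈ U, ∀ u v : E m, θ x u = 0 → θ x v = 0 →
    extDer σ x u v = covD Γ σ x u v - covD Γ σ x v u

/-- `∇_H T = 0`: by duality, the Reeb field `T` is parallel for the partial connection `Γ`
on `Λ¹` iff for every section `σ` of `Λ¹` and every `H`-direction `v` one has
`(∇_v σ)(T) = d_H(σ(T))(v)`. -/
def ReebParallel {m : ℕ} (V : Set (E m)) (θ : E m → Cov m) (T : E m → E m)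
    (Γ : Christoffel m) : Prop :=
  ∀ σ : E m → Cov m, SmoothOnD σ V → ∀ x ∈ V, ∀ v : E m, θ x v = 0 →
    covD Γ σ x v (T x) = fderiv ℝ (fun y => σ y (T y)) x v

/-- `∇_H θ = (dθ)_H`, where `(dθ)_H` is the image of `dθ` under
`Λ² ↪ Λ¹ ⊗ Λ¹ → Λ¹_H ⊗ Λ¹` (first slot restricted to `H`, second slot arbitrary). -/
def CompatDTheta {m : ℕ} (V : Set (E m)) (θ : E m → Cov m) (Γ : Christoffel m) : Prop :=
  ∀ x ∈ V, ∀ v : E m, θ x v = 0 → ∀ w : E m, covD Γ θ x v w = extDer θ x v w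



/-- The fibre of a (trivialised) smooth vector bundle `V` of rank `k`. -/
abbrev Fib (k : ℕ) : Type := EuclideanSpace ℝ (Fin k)

/-- Christoffel symbols of a (partial or full) connection on the trivialised bundle with
fibre `Fib k`: the associated covariant derivative is
`∇_v σ (x) = fderiv σ x v + Γ x v (σ x)`. -/
abbrev ChristoffelV (m k : ℕ) : Type := E m → E m →L[ℝ] Fib k →L[ℝ] Fib k

/-- Covariant derivative on sections of the bundle with fibre `Fib k`. -/
def covDV {m k : ℕ} (Γ : ChristoffelV m k) (σ : E m → Fib k) (x v : E m) : Fib k :=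
  fderiv ℝ σ x v + Γ x v (σ x)

/-- The operator `∇_H : Λ¹ ⊗ V → Λ²_H ⊗ V` induced by a partial connection `ΓH` on `V`,
characterised by `∇_H (ω ⊗ σ) = d_H ω ⊗ σ - ω_H ∧ ∇_H σ`, applied to the `Λ¹ ⊗ V`-valued
section `x ↦ (v ↦ covDV Γfull σ x v)` obtained from a full connection `Γfull`; evaluated
on the pair of directions `(u, v)` (only `u, v ∈ H x` being relevant). -/
def secondOpV {m k : ℕ} (ΓH Γfull : ChristoffelV m k) (σ : E m → Fib k)
    (x u v : E m) : Fib k :=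
  fderiv ℝ (fun y => covDV Γfull σ y v) x u - fderiv ℝ (fun y => covDV Γfull σ y u) x v
    + ΓH x u (covDV Γfull σ x v) - ΓH x v (covDV Γfull σ x u)

/-- The coefficients of the curvature `∂Γ + Γ ∧ Γ`, as a bilinear form with values in
endomorphisms of the fibre. -/
def curvatureForm {m k : ℕ} (Γ : ChristoffelV m k) (x : E m) :
    E m →L[ℝ] E m →L[ℝ] (Fib k →L[ℝ] Fib k) :=
  let P := fderiv ℝ Γ x + (ContinuousLinearMap.compL ℝ (Fib k) (Fib k) (Fib k)).bilinearComp
    (Γ x) (Γ x)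
  P - P.flip

lemma curvatureForm_apply {m k : ℕ} (Γ : ChristoffelV m k) (x u v : E m) (f : Fib k) :
    curvatureForm Γ x u v f = fderiv ℝ Γ x u v f - fderiv ℝ Γ x v u f
      + Γ x u (Γ x v f) - Γ x v (Γ x u f) := by
  simp [curvatureForm]
  abel

lemma smoothOnD_curvatureForm {m k : ℕ} {U : Set (E m)} (hU : IsOpen U) {Γ : ChristoffelV m k}
    (hΓ : SmoothOnD Γ U) : SmoothOnD (curvatureForm Γ) U := by
  have hflip {F : Type} [NormedAddCommGroup F] [NormedSpace ℝ F] {F' : Type}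
      [NormedAddCommGroup F'] [NormedSpace ℝ F'] {P : E m → E m →L[ℝ] F →L[ℝ] F'}
      (hP : SmoothOnD P U) : SmoothOnD (fun x => (P x).flip) U :=
    (ContinuousLinearMap.flipₗᵢ ℝ (E m) F F').contDiff.comp_contDiffOn hP
  have hP : SmoothOnD (fun x => fderiv ℝ Γ x +
      (ContinuousLinearMap.compL ℝ (Fib k) (Fib k) (Fib k)).bilinearComp (Γ x) (Γ x)) U :=
    (hΓ.fderiv_of_isOpen hU (by simp)).add
      (hflip ((hflip (contDiffOn_const.clm_comp hΓ)).clm_comp hΓ))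
  exact hP.sub (hflip hP)

lemma SmoothOnD.differentiableAt {m : ℕ} {F : Type*} [NormedAddCommGroup F] [NormedSpace ℝ F]
    {f : E m → F} {U : Set (E m)} (hf : SmoothOnD f U) (hU : IsOpen U) {x : E m} (hx : x ∈ U) :
    DifferentiableAt ℝ f x :=
  (ContDiffOn.contDiffAt hf (hU.mem_nhds hx)).differentiableAt (by simp)

lemma fderiv_covDV {m k : ℕ} {U : Set (E m)} (hU : IsOpen U) {Γ : ChristoffelV m k}
    (hΓ : SmoothOnD Γ U) {σ : E m → Fib k} (hσ : SmoothOnD σ U) {x : E m} (hx : x ∈ U)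
    (u v : E m) :
    fderiv ℝ (fun y => covDV Γ σ y v) x u = fderiv ℝ (fderiv ℝ σ) x u v
      + (fderiv ℝ Γ x u v (σ x) + Γ x v (fderiv ℝ σ x u)) := by
  have h1 := (SmoothOnD.differentiableAt (hσ.fderiv_of_isOpen hU (m := (⊤ : ℕ∞)) (by simp))
    hU hx).hasFDerivAt.clm_apply (hasFDerivAt_const v x)
  have h2 := ((SmoothOnD.differentiableAt hΓ hU hx).hasFDerivAt.clm_apply
    (hasFDerivAt_const v x)).clm_apply (SmoothOnD.differentiableAt hσ hU hx).hasFDerivAt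
  have h : HasFDerivAt (fun y => covDV Γ σ y v) _ x := h1.add h2
  rw [h.fderiv]
  simp
  abel

/-- A smooth family of linear maps vanishing on the kernels of `θ` has the form `θ ⊗ A`; this
is the resulting formula for its derivative in the kernel directions. -/
lemma fderiv_apply_of_vanish_on_ker {m : ℕ} {F : Type*} [NormedAddCommGroup F]
    [NormedSpace ℝ F] {U : Set (E m)} (hU : IsOpen U) {θ : E m → Cov m} (hθ : SmoothOnD θ U)
    {D : E m → E m →L[ℝ] F} (hD : SmoothOnD D U)
    (hker : ∀ y ∈ U, ∀ v, θ y v = 0 → D y v = 0) {x : E m} (hx : x ∈ U) {w : E m}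
    (hw : θ x w = 1) (u : E m) {v : E m} (hv : θ x v = 0) :
    fderiv ℝ D x u v = fderiv ℝ θ x u v • D x w := by
  have hθx := (SmoothOnD.differentiableAt hθ hU hx).hasFDerivAt
  have hDx := (SmoothOnD.differentiableAt hD hU hx).hasFDerivAt
  have happ (z : E m) := hθx.clm_apply (hasFDerivAt_const z x)
  have hDapp (z : E m) := hDx.clm_apply (hasFDerivAt_const z x)
  have h1 := (happ w).smul (hDapp v)
  have h2 := (happ v).smul (hDapp w)
  have heq : (fun y => θ y w • D y v) =ᶠ[nhds x] fun y => θ y v • D y w := by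
    filter_upwards [hU.mem_nhds hx] with y hy
    have := hker y hy (θ y w • v - θ y v • w) (by simp [mul_comm])
    simpa [sub_eq_zero] using this
  have h3 := DFunLike.congr_fun (h1.unique (h2.congr_of_eventuallyEq heq)) u
  simpa [hw, hv, hker x hx v hv] using h3

/-- On `H`, the operator `∇_H ∘ ∇` is algebraic: it is the curvature of `ΓH` corrected by the
Levi form times the difference of `Γ` and `ΓH` in a transverse direction. -/
lemma secondOpV_eq {m k : ℕ} {U : Set (E m)} (hU : IsOpen U) {θ : E m → Cov m}
    (hθ : SmoothOnD θ U) {ΓH Γ : ChristoffelV m k} (hΓH : SmoothOnD ΓH U) (hΓ : SmoothOnD Γ U)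
    (hker : ∀ x ∈ U, ∀ v : E m, θ x v = 0 → ∀ f : Fib k, Γ x v f = ΓH x v f)
    {σ : E m → Fib k} (hσ : SmoothOnD σ U) {x : E m} (hx : x ∈ U) {w : E m} (hw : θ x w = 1)
    {u v : E m} (hu : θ x u = 0) (hv : θ x v = 0) :
    secondOpV ΓH Γ σ x u v = extDer θ x u v • (Γ x w (σ x) - ΓH x w (σ x))
      + curvatureForm ΓH x u v (σ x) := by
  have hD (u : E m) {v : E m} (hv : θ x v = 0) :
      fderiv ℝ Γ x u v (σ x) = fderiv ℝ ΓH x u v (σ x)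
        + fderiv ℝ θ x u v • (Γ x w (σ x) - ΓH x w (σ x)) := by
    have h := fderiv_apply_of_vanish_on_ker hU hθ (D := fun y => Γ y - ΓH y) (hΓ.sub hΓH)
      (fun y hy v hv => by ext1 f; simp [hker y hy v hv f]) hx hw u hv
    rw [fderiv_fun_sub (SmoothOnD.differentiableAt hΓ hU hx)
      (SmoothOnD.differentiableAt hΓH hU hx)] at h
    have := DFunLike.congr_fun h (σ x)
    simp only [sub_apply, smul_apply] at this
    rw [← this]
    abel
  have hsymm : fderiv ℝ (fderiv ℝ σ) x u v = fderiv ℝ (fderiv ℝ σ) x v u :=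
    ((ContDiffOn.contDiffAt hσ (hU.mem_nhds hx)).isSymmSndFDerivAt
      (by simpa using WithTop.coe_le_coe.2 (le_top : (2 : ℕ∞) ≤ ⊤))) u v
  rw [secondOpV, fderiv_covDV hU hΓ hσ hx, fderiv_covDV hU hΓ hσ hx, hD u hv, hD v hu, hsymm,
    curvatureForm_apply, extDer, covDV, covDV, hker x hx u hu, hker x hx v hv,
    hker x hx u hu, hker x hx v hv, map_add, map_add, sub_smul]
  abel

/-- Applying a linear functional to a family of vectors coordinatewise in a basis. -/
lemma Module.Basis.map_sum_functional_coord {R W X ι : Type*} [CommRing R] [AddCommGroup W]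
    [Module R W] [Fintype ι] (b : Module.Basis ι R W) (L : (X → R) →ₗ[R] R) (K : X → W)
    (ℓ : W →ₗ[R] R) :
    ℓ (∑ i, L (fun p => b.coord i (K p)) • b i) = L fun p => ℓ (K p) := by
  have h : (fun p => ℓ (K p)) = ∑ i, ℓ (b i) • fun p => b.coord i (K p) := by
    ext p
    conv_lhs => rw [← b.sum_repr (K p), map_sum]
    simp only [map_smul, smul_eq_mul, Finset.sum_apply, Pi.smul_apply, Module.Basis.coord_apply,
      mul_comm]
  rw [h]
  simp [mul_comm]

/-- Let `(M, H)` be a contact manifold and `V` a smooth vector bundle.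
A partial connection `∇_H` on `V` uniquely determines a full connection `∇` on `V` with:
(i) the composition `V → Λ¹ ⊗ V → Λ¹_H ⊗ V` of `∇` with the projection agrees with
`∇_H`, and (ii) the composition
`V →(∇) Λ¹ ⊗ V →(∇_H) Λ²_H ⊗ V →(𝓛⁻¹ ⊗ Id) L ⊗ V` vanishes, where
`𝓛⁻¹ : Λ²_H → L` is the inverse of the nondegenerate Levi form on its range.

`M` is modelled by an open set `U ⊆ ℝ^m` with contact form `θ` (so `L = span θ` is
trivialised by `θ`), `V` by a trivialised bundle with fibre `Fib k`, connections by
their Christoffel symbols, and `𝓛⁻¹` by a family `Linv` of linear functionals on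
bilinear forms, depending only on the restriction to `H × H` and sending the Levi form
`dθ|_H` (the image of `θ` under `𝓛`) to `1`. -/
theorem statement4 {m k : ℕ} (U : Set (E m)) (hU : IsOpen U)
    (θ : E m → Cov m) (hθ : IsContactForm U θ)
    -- the inverse of the Levi form, `𝓛⁻¹ : Λ²_H → L ≅ Λ⁰`:
    (Linv : E m → (E m → E m → ℝ) → ℝ)
    (hLadd : ∀ x ∈ U, ∀ b b' : E m → E m → ℝ,
      Linv x (fun u v => b u v + b' u v) = Linv x b + Linv x b')
    (hLsmul : ∀ x ∈ U, ∀ (c : ℝ) (b : E m → E m → ℝ),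
      Linv x (fun u v => c * b u v) = c * Linv x b)
    (hLH : ∀ x ∈ U, ∀ b b' : E m → E m → ℝ,
      (∀ u v : E m, θ x u = 0 → θ x v = 0 → b u v = b' u v) → Linv x b = Linv x b')
    (hLinverse : ∀ x ∈ U, Linv x (fun u v => extDer θ x u v) = 1)
    (hLsm : ∀ b : E m → (E m →L[ℝ] E m →L[ℝ] ℝ), SmoothOnD b U →
      SmoothOnD (fun x => Linv x (fun u v => b x u v)) U)
    -- the given partial connection on `V`:
    (ΓH : ChristoffelV m k) (hΓH : SmoothOnD ΓH U) :
    ∃ Γfull : ChristoffelV m k,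
      SmoothOnD Γfull U ∧
      -- (i) the `H`-part of the full connection is the given partial connection
      (∀ x ∈ U, ∀ v : E m, θ x v = 0 → ∀ f : Fib k, Γfull x v f = ΓH x v f) ∧
      -- (ii) `(𝓛⁻¹ ⊗ Id) ∘ ∇_H ∘ ∇` vanishes
      (∀ σ : E m → Fib k, SmoothOnD σ U → ∀ x ∈ U, ∀ φ : Fib k →L[ℝ] ℝ,
        Linv x (fun u v => φ (secondOpV ΓH Γfull σ x u v)) = 0) ∧
      -- uniqueness
      (∀ Γ' : ChristoffelV m k, SmoothOnD Γ' U →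
        (∀ x ∈ U, ∀ v : E m, θ x v = 0 → ∀ f : Fib k, Γ' x v f = ΓH x v f) →
        (∀ σ : E m → Fib k, SmoothOnD σ U → ∀ x ∈ U, ∀ φ : Fib k →L[ℝ] ℝ,
          Linv x (fun u v => φ (secondOpV ΓH Γ' σ x u v)) = 0) →
        ∀ x ∈ U, ∀ v : E m, ∀ f : Fib k, Γ' x v f = Γfull x v f) := by
  obtain ⟨hθs, hθn⟩ := hθ
  let G := Fib k →L[ℝ] Fib k
  let b := Module.finBasis ℝ G
  let A : E m → G := fun x =>
    -∑ i, Linv x (fun u v => b.coord i (curvatureForm ΓH x u v)) • b i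
  have hA : SmoothOnD A U := by
    have hcoord (i) : SmoothOnD
        (fun x => Linv x fun u v => b.coord i (curvatureForm ΓH x u v)) U := by
      let ℓ : G →L[ℝ] ℝ := LinearMap.toContinuousLinearMap (b.coord i)
      have hℓ : SmoothOnD (fun x => (ContinuousLinearMap.compL ℝ (E m) G ℝ ℓ).comp
          (curvatureForm ΓH x)) U :=
        contDiffOn_const.clm_comp (smoothOnD_curvatureForm hU hΓH)
      exact hLsm _ hℓ
    have hterm (i) : SmoothOnD
        (fun x => Linv x (fun u v => b.coord i (curvatureForm ΓH x u v)) • b i) U :=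
      (hcoord i).smul contDiffOn_const
    have hsum := ContDiffOn.sum (s := Finset.univ) fun i _ => hterm i
    exact hsum.neg
  have hAapply : ∀ x ∈ U, ∀ (φ : Fib k →L[ℝ] ℝ) (f : Fib k),
      φ (A x f) = -Linv x (fun u v => φ (curvatureForm ΓH x u v f)) := by
    intro x hx φ f
    let L : (E m × E m → ℝ) →ₗ[ℝ] ℝ :=
      { toFun := fun B => Linv x fun u v => B (u, v)
        map_add' := fun B B' => hLadd x hx _ _
        map_smul' := fun c B => hLsmul x hx c _ }
    let ℓ : G →ₗ[ℝ] ℝ :=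
      { toFun := fun g => φ (g f)
        map_add' := fun g g' => φ.map_add _ _
        map_smul' := fun c g => φ.map_smul c _ }
    have h := b.map_sum_functional_coord L (fun p => curvatureForm ΓH x p.1 p.2) ℓ
    simpa [A, L, ℓ] using congrArg Neg.neg h
  have htrans : ∀ x ∈ U, ∃ w, θ x w = 1 := by
    intro x hx
    obtain ⟨w, hw⟩ := DFunLike.ne_iff.mp (hθn x hx).1
    exact ⟨(θ x w)⁻¹ • w, by simpa using inv_mul_cancel₀ hw⟩
  have hkey : ∀ Γ : ChristoffelV m k, SmoothOnD Γ U →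
      (∀ x ∈ U, ∀ v : E m, θ x v = 0 → ∀ f : Fib k, Γ x v f = ΓH x v f) →
      ∀ σ : E m → Fib k, SmoothOnD σ U → ∀ x ∈ U, ∀ w, θ x w = 1 → ∀ φ : Fib k →L[ℝ] ℝ,
        Linv x (fun u v => φ (secondOpV ΓH Γ σ x u v)) =
          φ (Γ x w (σ x) - ΓH x w (σ x) - A x (σ x)) := by
    intro Γ hΓ hker σ hσ x hx w hw φ
    rw [hLH x hx _ (fun u v => φ (Γ x w (σ x) - ΓH x w (σ x)) * extDer θ x u v
        + φ (curvatureForm ΓH x u v (σ x))), hLadd x hx, hLsmul x hx, hLinverse x hx, map_sub, map_sub,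
      map_sub, hAapply x hx]
    · ring
    · intro u v hu hv
      rw [secondOpV_eq hU hθs hΓH hΓ hker hσ hx hw hu hv, map_add, map_smul, smul_eq_mul,
        mul_comm]
  have hfull : SmoothOnD (fun x => ΓH x + (θ x).smulRight (A x)) U :=
    hΓH.add (hθs.smulRight hA)
  have hker : ∀ x ∈ U, ∀ v : E m, θ x v = 0 → ∀ f : Fib k,
      (ΓH x + (θ x).smulRight (A x)) v f = ΓH x v f := by
    intro x _ v hv f
    simp [hv]
  refine ⟨_, hfull, hker, ?_, ?_⟩
  · intro σ hσ x hx φ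
    obtain ⟨w, hw⟩ := htrans x hx
    rw [hkey _ hfull hker σ hσ x hx w hw φ]
    simp [hw]
  · intro Γ' hΓ' hker' hvan x hx v f
    obtain ⟨w, hw⟩ := htrans x hx
    have hwf : Γ' x w f - ΓH x w f - A x f = 0 := by
      ext i
      have h := hkey Γ' hΓ' hker' (fun _ => f) contDiffOn_const x hx w hw
        (EuclideanSpace.proj i)
      rw [hvan _ contDiffOn_const x hx] at h
      simpa using h.symm
    have hv : Γ' x (v - θ x v • w) f = ΓH x (v - θ x v • w) f :=
      hker' x hx _ (by simp [hw]) f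
    simp only [map_sub, map_smul, sub_apply,
      smul_apply] at hv
    have hwf' : Γ' x w f = ΓH x w f + A x f := by
      rw [← sub_eq_zero, ← hwf]
      abel
    rw [hwf', smul_add] at hv
    simp only [add_apply, ContinuousLinearMap.smulRight_apply,
      smul_apply]
    rw [sub_eq_iff_eq_add.mp hv]
    abel
end
end

section
/- Every strictly pseudo-convex pseudo-Hermitian structure (M, H, J, θ) of dimension 2n+1 determines an oriented sub-Riemannian contact structure, by taking g(X,Y) = Ω(X, JY) as sub-Riemannian metric (where Ω = dθ restricted to H) and using J to orient H; and in dimension 3 this inclusion is an equality, i.e. every oriented sub-Riemannian contact 3-manifold arises in this way. In local coframes in which g is the identity and Ω is in block-diagonal normal form with parameters λ₁,…,λ_n, the pseudo-Hermitian (CR) case corresponds exactly to λ₁ = ⋯ = λ_n = 1. -/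
set_option maxSynthPendingDepth 5

noncomputable section

/-- The exterior derivative of a 1-form at a point, as a continuous bilinear form. -/
def extDerForm {m : ℕ} (α : E m → Cov m) (x : E m) : E m →L[ℝ] E m →L[ℝ] ℝ :=
  fderiv ℝ α x - (fderiv ℝ α x).flip

theorem extDerForm_apply {m : ℕ} (α : E m → Cov m) (x u v : E m) :
    extDerForm α x u v = extDer α x u v := rfl

theorem extDerForm_antisymm {m : ℕ} (α : E m → Cov m) (x u v : E m) :
    extDerForm α x u v = -extDerForm α x v u := by
  simp [extDerForm]

theorem smoothOnD_extDerForm {m : ℕ} {U : Set (E m)} (hU : IsOpen U) {α : E m → Cov m}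
    (hα : SmoothOnD α U) : SmoothOnD (extDerForm α) U := by
  have h : ContDiffOn ℝ (⊤ : ℕ∞) (fderiv ℝ α) U := hα.fderiv_of_isOpen hU (by simp)
  exact h.sub ((ContinuousLinearMap.flipₗᵢ ℝ (E m) (E m) ℝ).contDiff.comp_contDiffOn h)

theorem extDer_smul {m : ℕ} {f : E m → ℝ} {α : E m → Cov m} {x : E m}
    (hf : DifferentiableAt ℝ f x) (hα : DifferentiableAt ℝ α x) {u v : E m}
    (hu : α x u = 0) (hv : α x v = 0) :
    extDer (fun y => f y • α y) x u v = f x * extDer α x u v := by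
  simp only [extDer, fderiv_fun_smul hf hα]
  simp [hu, hv]
  ring

/-- The coordinate vectors of `ℝ³`. -/
abbrev coordVec (i : Fin 3) : E 3 := EuclideanSpace.single i 1

theorem eq_sum_coordVec (v : E 3) :
    v = v 0 • coordVec 0 + v 1 • coordVec 1 + v 2 • coordVec 2 := by
  ext i
  fin_cases i <;> simp

theorem covector_apply (α : Cov 3) (v : E 3) :
    α v = v 0 * α (coordVec 0) + v 1 * α (coordVec 1) + v 2 * α (coordVec 2) := by
  conv_lhs => rw [eq_sum_coordVec v]
  simp only [map_add, map_smul, smul_eq_mul]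

theorem bilin_apply (ω : E 3 →L[ℝ] E 3 →L[ℝ] ℝ) (u w : E 3) :
    ω u w = u 0 * ω (coordVec 0) w + u 1 * ω (coordVec 1) w + u 2 * ω (coordVec 2) w :=
  covector_apply (ω.flip w) u

/-- The coefficient of the 3-form `α ∧ ω` on `ℝ³`, for a covector `α` and a 2-form `ω`. -/
def wedgeCoeff (α : Cov 3) (ω : E 3 →L[ℝ] E 3 →L[ℝ] ℝ) : ℝ :=
  α (coordVec 0) * ω (coordVec 1) (coordVec 2) + α (coordVec 1) * ω (coordVec 2) (coordVec 0) +
    α (coordVec 2) * ω (coordVec 0) (coordVec 1)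

/-- The adjugate quadratic form of `g` evaluated on `α`: up to a common factor, the Gram
determinant of `g` on `ker α`. -/
def adjugateForm (α : Cov 3) (g : E 3 →L[ℝ] E 3 →L[ℝ] ℝ) : ℝ :=
  let G := fun i j => g (coordVec i) (coordVec j)
  α (coordVec 0) ^ 2 * (G 1 1 * G 2 2 - G 1 2 * G 1 2) +
  α (coordVec 1) ^ 2 * (G 0 0 * G 2 2 - G 0 2 * G 0 2) +
  α (coordVec 2) ^ 2 * (G 0 0 * G 1 1 - G 0 1 * G 0 1) +
  2 * α (coordVec 0) * α (coordVec 1) * (G 0 2 * G 1 2 - G 0 1 * G 2 2) +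
  2 * α (coordVec 0) * α (coordVec 2) * (G 0 1 * G 1 2 - G 0 2 * G 1 1) +
  2 * α (coordVec 1) * α (coordVec 2) * (G 0 1 * G 0 2 - G 1 2 * G 0 0)

/-- The endomorphism `w ↦ α × g w` of `ℝ³`. -/
def crossEnd (α : Cov 3) (g : E 3 →L[ℝ] E 3 →L[ℝ] ℝ) : E 3 →L[ℝ] E 3 :=
  (α (coordVec 1) • g (coordVec 2) - α (coordVec 2) • g (coordVec 1)).smulRight (coordVec 0) +
  (α (coordVec 2) • g (coordVec 0) - α (coordVec 0) • g (coordVec 2)).smulRight (coordVec 1) +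
  (α (coordVec 0) • g (coordVec 1) - α (coordVec 1) • g (coordVec 0)).smulRight (coordVec 2)

section Pointwise

variable {α : Cov 3} {g ω η : E 3 →L[ℝ] E 3 →L[ℝ] ℝ}

theorem antisymm_self (hω : ∀ u w, ω u w = -ω w u) (u : E 3) : ω u u = 0 := by
  linarith [hω u u]

theorem antisymm_apply (hω : ∀ u w, ω u w = -ω w u) (u w : E 3) :
    ω u w = (u 1 * w 2 - u 2 * w 1) * ω (coordVec 1) (coordVec 2) +
      (u 2 * w 0 - u 0 * w 2) * ω (coordVec 2) (coordVec 0) +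
      (u 0 * w 1 - u 1 * w 0) * ω (coordVec 0) (coordVec 1) := by
  rw [bilin_apply ω u w, covector_apply (ω (coordVec 0)) w, covector_apply (ω (coordVec 1)) w,
    covector_apply (ω (coordVec 2)) w, antisymm_self hω, antisymm_self hω, antisymm_self hω,
    hω (coordVec 1) (coordVec 0), hω (coordVec 2) (coordVec 1), hω (coordVec 0) (coordVec 2)]
  ring

theorem wedgeCoeff_mul_comm (hω : ∀ u w, ω u w = -ω w u) (hη : ∀ u w, η u w = -η w u)
    {u w : E 3} (hu : α u = 0) (hw : α w = 0) :
    wedgeCoeff α ω * η u w = wedgeCoeff α η * ω u w := by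
  rw [covector_apply] at hu hw
  rw [antisymm_apply hω u w, antisymm_apply hη u w, wedgeCoeff, wedgeCoeff]
  generalize ω (coordVec 1) (coordVec 2) = b0, ω (coordVec 2) (coordVec 0) = b1,
    ω (coordVec 0) (coordVec 1) = b2, η (coordVec 1) (coordVec 2) = c0,
    η (coordVec 2) (coordVec 0) = c1, η (coordVec 0) (coordVec 1) = c2 at *
  linear_combination
    (u 0 * (b1 * c2 - b2 * c1) + u 1 * (b2 * c0 - b0 * c2) + u 2 * (b0 * c1 - b1 * c0)) * hw -
    (w 0 * (b1 * c2 - b2 * c1) + w 1 * (b2 * c0 - b0 * c2) + w 2 * (b0 * c1 - b1 * c0)) * hu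

theorem wedgeCoeff_ne_zero (hα : α ≠ 0) (hω : ∀ u w, ω u w = -ω w u) {u w : E 3}
    (hu : α u = 0) (hw : α w = 0) (h : ω u w ≠ 0) : wedgeCoeff α ω ≠ 0 := by
  intro h0
  rw [covector_apply] at hu hw
  rw [antisymm_apply hω u w] at h
  rw [wedgeCoeff] at h0
  refine hα (ContinuousLinearMap.ext fun v => ?_)
  rw [covector_apply]
  generalize ω (coordVec 1) (coordVec 2) = b0, ω (coordVec 2) (coordVec 0) = b1,
    ω (coordVec 0) (coordVec 1) = b2, α (coordVec 0) = a0, α (coordVec 1) = a1,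
    α (coordVec 2) = a2 at *
  have h0' : a0 = 0 := (mul_eq_zero.1 (show a0 * _ = 0 by
    linear_combination (u 1 * w 2 - u 2 * w 1) * h0 + (w 1 * b2 - w 2 * b1) * hu
      - (u 1 * b2 - u 2 * b1) * hw)).resolve_right h
  have h1' : a1 = 0 := (mul_eq_zero.1 (show a1 * _ = 0 by
    linear_combination (u 2 * w 0 - u 0 * w 2) * h0 + (w 2 * b0 - w 0 * b2) * hu
      - (u 2 * b0 - u 0 * b2) * hw)).resolve_right h
  have h2' : a2 = 0 := (mul_eq_zero.1 (show a2 * _ = 0 by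
    linear_combination (u 0 * w 1 - u 1 * w 0) * h0 + (w 0 * b1 - w 1 * b0) * hu
      - (u 0 * b1 - u 1 * b0) * hw)).resolve_right h
  simp [h0', h1', h2']

theorem apply_crossEnd (α : Cov 3) (g : E 3 →L[ℝ] E 3 →L[ℝ] ℝ) (w : E 3) :
    α (crossEnd α g w) = 0 := by
  simp [crossEnd]
  ring

theorem antisymm_crossEnd (hω : ∀ u w, ω u w = -ω w u) {v : E 3} (hv : α v = 0) (w : E 3) :
    ω v (crossEnd α g w) = wedgeCoeff α ω * g v w := by
  rw [covector_apply] at hv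
  rw [antisymm_apply hω, bilin_apply g v w, wedgeCoeff]
  simp [crossEnd]
  generalize ω (coordVec 1) (coordVec 2) = b0, ω (coordVec 2) (coordVec 0) = b1,
    ω (coordVec 0) (coordVec 1) = b2, α (coordVec 0) = a0, α (coordVec 1) = a1,
    α (coordVec 2) = a2, g (coordVec 0) w = g0, g (coordVec 1) w = g1,
    g (coordVec 2) w = g2 at *
  linear_combination (-(b0 * g0 + b1 * g1 + b2 * g2)) * hv

theorem crossEnd_crossEnd (hg : ∀ u w, g u w = g w u) {w : E 3} (hw : α w = 0) :
    crossEnd α g (crossEnd α g w) = -adjugateForm α g • w := by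
  rw [covector_apply] at hw
  have h10 := hg (coordVec 1) (coordVec 0)
  have h20 := hg (coordVec 2) (coordVec 0)
  have h21 := hg (coordVec 2) (coordVec 1)
  have e0 := covector_apply (g (coordVec 0)) w
  have e1 := covector_apply (g (coordVec 1)) w
  have e2 := covector_apply (g (coordVec 2)) w
  rw [h10] at e1
  rw [h20, h21] at e2
  ext i
  fin_cases i <;> simp [crossEnd, adjugateForm, h10, h20, h21, e0, e1, e2] <;>
  generalize g (coordVec 0) (coordVec 0) = g00, g (coordVec 0) (coordVec 1) = g01,
    g (coordVec 0) (coordVec 2) = g02, g (coordVec 1) (coordVec 1) = g11,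
    g (coordVec 1) (coordVec 2) = g12, g (coordVec 2) (coordVec 2) = g22,
    α (coordVec 0) = a0, α (coordVec 1) = a1, α (coordVec 2) = a2 at *
  · linear_combination ((g11 * g22 - g12 * g12) * a0 + (g02 * g12 - g01 * g22) * a1 +
      (g01 * g12 - g02 * g11) * a2) * hw
  · linear_combination ((g02 * g12 - g01 * g22) * a0 + (g00 * g22 - g02 * g02) * a1 +
      (g01 * g02 - g12 * g00) * a2) * hw
  · linear_combination ((g01 * g12 - g02 * g11) * a0 + (g01 * g02 - g12 * g00) * a1 +
      (g00 * g11 - g01 * g01) * a2) * hw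

theorem adjugateForm_pos (hg : ∀ u w, g u w = g w u) (hpos : ∀ v, α v = 0 → v ≠ 0 → 0 < g v v)
    (hω : ∀ u w, ω u w = -ω w u) (hαω : wedgeCoeff α ω ≠ 0) {w : E 3} (hw : α w = 0)
    (hw0 : w ≠ 0) : 0 < adjugateForm α g := by
  have hww := hpos w hw hw0
  have h1 := antisymm_crossEnd (g := g) hω hw w
  have hc : crossEnd α g w ≠ 0 := by
    intro h
    rw [h, map_zero] at h1
    exact mul_ne_zero hαω hww.ne' h1.symm
  have hcc := hpos _ (apply_crossEnd α g w) hc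
  have h2 := antisymm_crossEnd (g := g) hω (apply_crossEnd α g w) (crossEnd α g w)
  rw [crossEnd_crossEnd hg hw, map_smul, hω, h1, smul_eq_mul] at h2
  have h3 : adjugateForm α g * g w w = g (crossEnd α g w) (crossEnd α g w) := by
    apply mul_left_cancel₀ hαω
    linear_combination h2
  exact pos_of_mul_pos_left (h3 ▸ hcc) hww.le

end Pointwise

section Smoothness

variable {U : Set (E 3)} {α : E 3 → Cov 3} {g ω : E 3 → (E 3 →L[ℝ] E 3 →L[ℝ] ℝ)}

theorem SmoothOnD.apply_const {F G : Type*} [NormedAddCommGroup F] [NormedSpace ℝ F]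
    [NormedAddCommGroup G] [NormedSpace ℝ G] {β : E 3 → (F →L[ℝ] G)} (hβ : SmoothOnD β U)
    (v : F) : SmoothOnD (fun x => β x v) U :=
  ContDiffOn.clm_apply hβ contDiffOn_const

theorem smoothOnD_wedgeCoeff (hα : SmoothOnD α U) (hω : SmoothOnD ω U) :
    SmoothOnD (fun x => wedgeCoeff (α x) (ω x)) U := by
  have ha := fun i => SmoothOnD.apply_const hα (coordVec i)
  have hw := fun i j => SmoothOnD.apply_const (SmoothOnD.apply_const hω (coordVec i)) (coordVec j)
  exact (((ha 0).mul (hw 1 2)).add ((ha 1).mul (hw 2 0))).add ((ha 2).mul (hw 0 1))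

theorem smoothOnD_adjugateForm (hα : SmoothOnD α U) (hg : SmoothOnD g U) :
    SmoothOnD (fun x => adjugateForm (α x) (g x)) U := by
  have ha := fun i => SmoothOnD.apply_const hα (coordVec i)
  have hG := fun i j => SmoothOnD.apply_const (SmoothOnD.apply_const hg (coordVec i)) (coordVec j)
  have hminor : ∀ i j k l p q r s, SmoothOnD (fun x =>
      g x (coordVec i) (coordVec j) * g x (coordVec k) (coordVec l) -
        g x (coordVec p) (coordVec q) * g x (coordVec r) (coordVec s)) U :=
    fun i j k l p q r s => ((hG i j).mul (hG k l)).sub ((hG p q).mul (hG r s))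
  have hcross : ∀ i j, SmoothOnD (fun x => 2 * α x (coordVec i) * α x (coordVec j)) U :=
    fun i j => (contDiffOn_const.mul (ha i)).mul (ha j)
  exact ((((((ha 0).pow 2).mul (hminor _ _ _ _ _ _ _ _)).add
    (((ha 1).pow 2).mul (hminor _ _ _ _ _ _ _ _))).add
    (((ha 2).pow 2).mul (hminor _ _ _ _ _ _ _ _))).add
    ((hcross 0 1).mul (hminor _ _ _ _ _ _ _ _))).add
    ((hcross 0 2).mul (hminor _ _ _ _ _ _ _ _)) |>.add
    ((hcross 1 2).mul (hminor _ _ _ _ _ _ _ _))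

theorem smoothOnD_crossEnd (hα : SmoothOnD α U) (hg : SmoothOnD g U) :
    SmoothOnD (fun x => crossEnd (α x) (g x)) U := by
  have hs : ∀ (i j : Fin 3) (v : E 3), SmoothOnD (fun x =>
      (α x (coordVec i) • g x (coordVec j) - α x (coordVec j) • g x (coordVec i)).smulRight v) U :=
    fun i j v => ContDiffOn.smulRight
      (((SmoothOnD.apply_const hα _).smul (SmoothOnD.apply_const hg _)).sub
        ((SmoothOnD.apply_const hα _).smul (SmoothOnD.apply_const hg _))) contDiffOn_const
  exact ((hs 1 2 _).add (hs 2 0 _)).add (hs 0 1 _)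

end Smoothness

theorem exists_subRiemannian_metric {m : ℕ} {U : Set (E m)} (hU : IsOpen U) {θ : E m → Cov m}
    {J : E m → (E m →L[ℝ] E m)} (hθ : SmoothOnD θ U) (hJ : SmoothOnD J U) :
    ∃ g : E m → (E m →L[ℝ] E m →L[ℝ] ℝ), SmoothOnD g U ∧
      ∀ x v w, g x v w = extDer θ x v (J x w) := by
  refine ⟨fun x => ((extDerForm θ x).flip.comp (J x)).flip, ?_, fun x v w => rfl⟩
  have hflip := (ContinuousLinearMap.flipₗᵢ ℝ (E m) (E m) ℝ).contDiff (n := (⊤ : ℕ∞))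
  exact hflip.comp_contDiffOn
    ((hflip.comp_contDiffOn (smoothOnD_extDerForm hU hθ)).clm_comp hJ)

theorem exists_pseudoHermitian_of_subRiemannian {U : Set (E 3)} (hU : IsOpen U)
    {θ₀ : E 3 → Cov 3} {g ν : E 3 → (E 3 →L[ℝ] E 3 →L[ℝ] ℝ)}
    (hθ₀ : IsContactForm U θ₀) (hg : SmoothOnD g U)
    (hgsymm : ∀ x ∈ U, ∀ u w : E 3, g x u w = g x w u)
    (hgpos : ∀ x ∈ U, ∀ v : E 3, θ₀ x v = 0 → v ≠ 0 → 0 < g x v v)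
    (hν : SmoothOnD ν U) (hνanti : ∀ x ∈ U, ∀ u w : E 3, ν x u w = -ν x w u)
    (hνne : ∀ x ∈ U, ∃ u w : E 3, θ₀ x u = 0 ∧ θ₀ x w = 0 ∧ ν x u w ≠ 0) :
    ∃ (θ : E 3 → Cov 3) (J : E 3 → (E 3 →L[ℝ] E 3)),
      (∀ x ∈ U, ∀ v : E 3, θ x v = 0 ↔ θ₀ x v = 0) ∧
      IsContactForm U θ ∧ SmoothOnD J U ∧
      (∀ x ∈ U, ∀ u w : E 3, θ₀ x u = 0 → θ₀ x w = 0 → 0 ≤ ν x u w * extDer θ x u w) ∧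
      (∀ x ∈ U, ∀ v : E 3, θ₀ x v = 0 → θ₀ x (J x v) = 0) ∧
      (∀ x ∈ U, ∀ v : E 3, θ₀ x v = 0 → J x (J x v) = -v) ∧
      (∀ x ∈ U, ∀ v w : E 3, θ₀ x v = 0 → θ₀ x w = 0 → extDer θ x v (J x w) = g x v w) := by
  obtain ⟨hθs, hθ⟩ := hθ₀
  have hanti : ∀ x (u w : E 3), extDerForm θ₀ x u w = -extDerForm θ₀ x w u :=
    extDerForm_antisymm θ₀
  set N : E 3 → ℝ := fun x => wedgeCoeff (θ₀ x) (ν x) with hN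
  set B : E 3 → ℝ := fun x => wedgeCoeff (θ₀ x) (extDerForm θ₀ x) with hB
  set D : E 3 → ℝ := fun x => adjugateForm (θ₀ x) (g x) with hD
  have hN0 : ∀ x ∈ U, N x ≠ 0 := fun x hx => by
    obtain ⟨u, w, hu, hw, h⟩ := hνne x hx
    exact wedgeCoeff_ne_zero (hθ x hx).1 (hνanti x hx) hu hw h
  have hνΩ : ∀ x ∈ U, ∀ u w : E 3, θ₀ x u = 0 → θ₀ x w = 0 →
      N x * extDer θ₀ x u w = B x * ν x u w := fun x hx u w hu hw =>
    wedgeCoeff_mul_comm (hνanti x hx) (hanti x) hu hw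
  have hv0 : ∀ x ∈ U, ∃ w : E 3, θ₀ x w = 0 ∧ w ≠ 0 := fun x hx => by
    obtain ⟨u, w, -, hw, h⟩ := hνne x hx
    exact ⟨w, hw, fun h0 => h (by rw [h0, map_zero])⟩
  have hB0 : ∀ x ∈ U, B x ≠ 0 := fun x hx h0 => by
    obtain ⟨v, hv, hv1⟩ := hv0 x hx
    refine hv1 ((hθ x hx).2 v hv fun w hw => ?_)
    have := hνΩ x hx v w hv hw
    rw [h0, zero_mul] at this
    exact (mul_eq_zero.1 this).resolve_left (hN0 x hx)
  have hDpos : ∀ x ∈ U, 0 < D x := fun x hx => by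
    obtain ⟨v, hv, hv1⟩ := hv0 x hx
    exact adjugateForm_pos (hgsymm x hx) (hgpos x hx) (hanti x) (hB0 x hx) hv hv1
  have hNs : SmoothOnD N U := smoothOnD_wedgeCoeff hθs hν
  have hBs : SmoothOnD B U := smoothOnD_wedgeCoeff hθs (smoothOnD_extDerForm hU hθs)
  have hDs : SmoothOnD D U := smoothOnD_adjugateForm hθs hg
  set r : E 3 → ℝ := fun x => √(D x / N x ^ 2) with hr
  have hquot : ∀ x ∈ U, 0 < D x / N x ^ 2 := fun x hx => by
    have := hDpos x hx
    have := hN0 x hx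
    positivity
  have hrpos : ∀ x ∈ U, 0 < r x := fun x hx => Real.sqrt_pos.2 (hquot x hx)
  have hrs : SmoothOnD r U :=
    (hDs.div (hNs.pow 2) fun x hx => pow_ne_zero 2 (hN0 x hx)).sqrt fun x hx => (hquot x hx).ne'
  have hκs : SmoothOnD (fun x => N x * r x) U := hNs.mul hrs
  have hκ0 : ∀ x ∈ U, N x * r x ≠ 0 := fun x hx => mul_ne_zero (hN0 x hx) (hrpos x hx).ne'
  have hκsq : ∀ x ∈ U, (N x * r x) ^ 2 = D x := fun x hx => by
    have := hN0 x hx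
    rw [mul_pow, Real.sq_sqrt (hquot x hx).le]
    field_simp
  set f : E 3 → ℝ := fun x => N x * r x / B x with hf
  have hfs : SmoothOnD f U := hκs.div hBs hB0
  have hf0 : ∀ x ∈ U, f x ≠ 0 := fun x hx => div_ne_zero (hκ0 x hx) (hB0 x hx)
  have hdθ : ∀ x ∈ U, ∀ u w : E 3, θ₀ x u = 0 → θ₀ x w = 0 →
      extDer (fun y => f y • θ₀ y) x u w = f x * extDer θ₀ x u w := fun x hx u w hu hw =>
    extDer_smul ((hfs.contDiffAt (hU.mem_nhds hx)).differentiableAt (by simp))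
      ((hθs.contDiffAt (hU.mem_nhds hx)).differentiableAt (by simp)) hu hw
  have hker : ∀ x ∈ U, ∀ v : E 3, (f x • θ₀ x) v = 0 ↔ θ₀ x v = 0 := fun x hx v => by
    simp [hf0 x hx]
  refine ⟨fun x => f x • θ₀ x, fun x => (N x * r x)⁻¹ • crossEnd (θ₀ x) (g x), hker,
    ⟨hfs.smul hθs, fun x hx => ⟨smul_ne_zero (hf0 x hx) (hθ x hx).1, fun v hv h => ?_⟩⟩,
    (hκs.inv hκ0).smul (smoothOnD_crossEnd hθs hg), fun x hx u w hu hw => ?_,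
    fun x hx v _ => ?_, fun x hx v hv => ?_, fun x hx v w hv hw => ?_⟩
  · rw [hker x hx] at hv
    refine (hθ x hx).2 v hv fun w hw => ?_
    have := h w ((hker x hx w).2 hw)
    rw [hdθ x hx v w hv hw] at this
    exact (mul_eq_zero.1 this).resolve_left (hf0 x hx)
  · have hΩ : f x * extDer θ₀ x u w = r x * ν x u w := by
      have := hB0 x hx
      rw [hf]
      field_simp
      linear_combination r x * hνΩ x hx u w hu hw
    rw [hdθ x hx u w hu hw, hΩ, mul_left_comm]
    exact mul_nonneg (hrpos x hx).le (mul_self_nonneg _)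
  · simp [apply_crossEnd]
  · have := hκ0 x hx
    have h1 : (N x * r x)⁻¹ * ((N x * r x)⁻¹ * D x) = 1 := by
      rw [← hκsq x hx, sq, inv_mul_cancel_left₀ this, inv_mul_cancel₀ this]
    simp only [_root_.smul_apply, map_smul, crossEnd_crossEnd (hgsymm x hx) hv]
    rw [neg_smul, smul_neg, smul_neg, smul_smul, smul_smul, mul_assoc]
    change -(((N x * r x)⁻¹ * ((N x * r x)⁻¹ * D x)) • v) = -v
    rw [h1, one_smul]
  · have hc := antisymm_crossEnd (g := g x) (hanti x) hv w
    rw [extDerForm_apply] at hc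
    change _ = B x * _ at hc
    have hJ : θ₀ x (((N x * r x)⁻¹ • crossEnd (θ₀ x) (g x)) w) = 0 := by simp [apply_crossEnd]
    rw [hdθ x hx v _ hv hJ, ← extDerForm_apply, _root_.smul_apply, map_smul,
      extDerForm_apply, hc, smul_eq_mul, hf]
    change N x * r x / B x * ((N x * r x)⁻¹ * (B x * g x v w)) = g x v w
    rw [mul_left_comm _ (B x), ← mul_assoc, div_mul_cancel₀ _ (hB0 x hx),
      mul_inv_cancel_left₀ (hκ0 x hx)]

section LinearAlgebra

variable {V : Type*} [AddCommGroup V] [Module ℝ V]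

theorem linearIndependent_of_orthonormal {ι : Type*} [DecidableEq ι] {g : V →ₗ[ℝ] V →ₗ[ℝ] ℝ}
    {e : ι → V} (he : ∀ i j, g (e i) (e j) = if i = j then 1 else 0) :
    LinearIndependent ℝ e := by
  rw [linearIndependent_iff']
  intro s c hc i hi
  have := congrArg (g (e i)) hc
  simpa [he, hi] using this

theorem exists_unitary_family [FiniteDimensional ℝ V] {n : ℕ} (hn : Module.finrank ℝ V = 2 * n)
    {g : V →ₗ[ℝ] V →ₗ[ℝ] ℝ} (hsymm : ∀ u v, g u v = g v u) (hpos : ∀ v, v ≠ 0 → 0 < g v v)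
    {J : V →ₗ[ℝ] V} (hJ : ∀ v w, g v (J w) = -g (J v) w) (k : ℕ) (hk : k ≤ n) :
    ∃ f : ℕ → V, ∀ i < k, ∀ j < k,
      g (f i) (f j) = (if i = j then 1 else 0) ∧ g (f i) (J (f j)) = 0 := by
  induction k with
  | zero => exact ⟨0, fun i hi => absurd hi (Nat.not_lt_zero i)⟩
  | succ k ih =>
    obtain ⟨f, hf⟩ := ih (by omega)
    let L : V →ₗ[ℝ] (Fin k ⊕ Fin k → ℝ) :=
      LinearMap.pi (Sum.elim (fun i => g (f i)) (fun i => g (J (f i))))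
    have hL : LinearMap.ker L ≠ ⊥ := by
      apply LinearMap.ker_ne_bot_of_finrank_lt
      simp [hn]
      omega
    obtain ⟨v, hv, hv0⟩ := Submodule.exists_mem_ne_zero_of_ne_bot hL
    have hv1 : ∀ i < k, g (f i) v = 0 := fun i hi => congrFun hv (Sum.inl ⟨i, hi⟩)
    have hv2 : ∀ i < k, g (J (f i)) v = 0 := fun i hi => congrFun hv (Sum.inr ⟨i, hi⟩)
    have hvv := hpos v hv0
    have hJself : g v (J v) = 0 := by linarith [hJ v v, hsymm v (J v)]
    have hsq : √(g v v) * √(g v v) = g v v := Real.mul_self_sqrt hvv.le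
    have hs0 : √(g v v) ≠ 0 := (Real.sqrt_pos.2 hvv).ne'
    refine ⟨Function.update f k ((√(g v v))⁻¹ • v), fun i hi j hj => ?_⟩
    rcases Nat.lt_succ_iff_lt_or_eq.1 hi with hi | rfl <;>
      rcases Nat.lt_succ_iff_lt_or_eq.1 hj with hj | rfl
    · simpa [hi.ne, hj.ne] using hf i hi j hj
    · simp [hi.ne, hv1 i hi, hJ, hv2 i hi]
    · simp [hj.ne, hj.ne', hsymm v, hv1 j hj, hv2 j hj]
    · simp only [Function.update_self, map_smul, LinearMap.smul_apply, hJself, smul_eq_mul,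
        mul_zero, if_true, and_true]
      rw [← mul_assoc, ← mul_inv, hsq, inv_mul_cancel₀ hvv.ne']

theorem exists_unitary_coframe [FiniteDimensional ℝ V] {n : ℕ}
    (hn : Module.finrank ℝ V = 2 * n)
    {g Ω : V →ₗ[ℝ] V →ₗ[ℝ] ℝ} (hsymm : ∀ u v, g u v = g v u) (hpos : ∀ v, v ≠ 0 → 0 < g v v)
    (hΩ : ∀ u v, Ω u v = -Ω v u)
    {J : V →ₗ[ℝ] V} (hJJ : ∀ v, J (J v) = -v) (hΩJ : ∀ v w, Ω v (J w) = g v w) :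
    ∃ e : Fin (2 * n) → V,
      (∀ i j, g (e i) (e j) = if i = j then 1 else 0) ∧
      Submodule.span ℝ (Set.range e) = ⊤ ∧
      (∀ i j : Fin (2 * n), (i : ℕ) % 2 = 0 → (j : ℕ) = i + 1 → Ω (e i) (e j) = 1) ∧
      (∀ i j : Fin (2 * n), (i : ℕ) < (j : ℕ) →
        ¬((j : ℕ) = (i : ℕ) + 1 ∧ (i : ℕ) % 2 = 0) → Ω (e i) (e j) = 0) := by
  have hΩg : ∀ v w, Ω v w = -g v (J w) := fun v w => by simp [← hΩJ, hJJ]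
  have hJ : ∀ v w, g v (J w) = -g (J v) w := fun v w => by
    rw [← neg_eq_iff_eq_neg, ← hΩg, hΩ, hΩg, neg_neg, hsymm]
  obtain ⟨f, hf⟩ := exists_unitary_family hn hsymm hpos hJ n le_rfl
  let e : Fin (2 * n) → V := fun i =>
    if (i : ℕ) % 2 = 0 then f ((i : ℕ) / 2) else J (f ((i : ℕ) / 2))
  have he : ∀ i j, g (e i) (e j) = if i = j then 1 else 0 := by
    intro i j
    obtain ⟨h1, h2⟩ := hf ((i : ℕ) / 2) (by omega) ((j : ℕ) / 2) (by omega)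
    have h3 : g (J (f ((i : ℕ) / 2))) (f ((j : ℕ) / 2)) = 0 := by rw [← neg_eq_zero, ← hJ, h2]
    have hij : i = j ↔ (i : ℕ) % 2 = (j : ℕ) % 2 ∧ (i : ℕ) / 2 = (j : ℕ) / 2 := by
      rw [Fin.ext_iff]
      omega
    rcases Nat.mod_two_eq_zero_or_one i with hi | hi <;>
      rcases Nat.mod_two_eq_zero_or_one j with hj | hj <;>
      simp [e, hi, hj, hij, h1, h3, hJ, hJJ]
  refine ⟨e, he, ?_, fun i j hi hij => ?_, fun i j hij h => ?_⟩
  · exact (linearIndependent_of_orthonormal he).span_eq_top_of_card_eq_finrank' (by simp [hn])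
  · have h1 := (hf ((i : ℕ) / 2) (by omega) ((j : ℕ) / 2) (by omega)).1
    have hj : (j : ℕ) % 2 = 1 := by omega
    have hhalf : (i : ℕ) / 2 = (j : ℕ) / 2 := by omega
    simpa [e, hΩg, hJJ, hi, hj, hhalf] using h1
  · obtain ⟨h1, h2⟩ := hf ((i : ℕ) / 2) (by omega) ((j : ℕ) / 2) (by omega)
    have h3 : g (J (f ((i : ℕ) / 2))) (f ((j : ℕ) / 2)) = 0 := by rw [← neg_eq_zero, ← hJ, h2]
    have hne : (i : ℕ) % 2 ≠ (j : ℕ) % 2 → (i : ℕ) / 2 ≠ (j : ℕ) / 2 := by omega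
    rcases Nat.mod_two_eq_zero_or_one i with hi | hi <;>
      rcases Nat.mod_two_eq_zero_or_one j with hj | hj <;>
      simp [hi, hj] at hne <;>
      simp [e, hi, hj, hΩg, h1, h3, hJ, hJJ, hne]

theorem exists_complexStructure {n : ℕ}
    {g Ω : V →ₗ[ℝ] V →ₗ[ℝ] ℝ} (hΩ : ∀ u v, Ω u v = -Ω v u) {e : Fin (2 * n) → V}
    (he : ∀ i j, g (e i) (e j) = if i = j then 1 else 0)
    (hspan : Submodule.span ℝ (Set.range e) = ⊤)
    (hone : ∀ i j : Fin (2 * n), (i : ℕ) % 2 = 0 → (j : ℕ) = i + 1 → Ω (e i) (e j) = 1)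
    (h0 : ∀ i j : Fin (2 * n), (i : ℕ) < (j : ℕ) →
      ¬((j : ℕ) = (i : ℕ) + 1 ∧ (i : ℕ) % 2 = 0) → Ω (e i) (e j) = 0) :
    ∃ J : V →ₗ[ℝ] V, (∀ v, J (J v) = -v) ∧ ∀ v w, Ω v (J w) = g v w := by
  let b : Module.Basis (Fin (2 * n)) ℝ V :=
    Module.Basis.mk (linearIndependent_of_orthonormal he) hspan.ge
  have hb : ∀ i, b i = e i := Module.Basis.mk_apply _ _
  have hzero : ∀ i j : Fin (2 * n), ¬((j : ℕ) = (i : ℕ) + 1 ∧ (i : ℕ) % 2 = 0) →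
      ¬((i : ℕ) = (j : ℕ) + 1 ∧ (j : ℕ) % 2 = 0) → Ω (e i) (e j) = 0 := by
    intro i j hij hji
    rcases lt_trichotomy (i : ℕ) (j : ℕ) with h | h | h
    · exact h0 i j h hij
    · rw [Fin.ext h]
      linarith [hΩ (e j) (e j)]
    · rw [hΩ, h0 j i h hji, neg_zero]
  let J : V →ₗ[ℝ] V := b.constr ℝ fun i : Fin (2 * n) =>
    if h : (i : ℕ) % 2 = 0 then e ⟨i + 1, by omega⟩ else -e ⟨i - 1, by omega⟩
  have hJeven : ∀ i j : Fin (2 * n), (i : ℕ) % 2 = 0 → (j : ℕ) = i + 1 → J (e i) = e j := by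
    intro i j hi hij
    rw [← hb i, b.constr_basis, dif_pos hi]
    exact congrArg e (Fin.ext hij.symm)
  have hJodd : ∀ i j : Fin (2 * n), (i : ℕ) % 2 = 0 → (j : ℕ) = i + 1 → J (e j) = -e i := by
    intro i j hi hij
    rw [← hb j, b.constr_basis, dif_neg (by omega)]
    exact congrArg (fun k => -e k) (Fin.ext (by simp [hij]))
  have hpair : ∀ j : Fin (2 * n), ∃ k : Fin (2 * n),
      ((j : ℕ) % 2 = 0 ∧ (k : ℕ) = j + 1) ∨ ((k : ℕ) % 2 = 0 ∧ (j : ℕ) = k + 1) := by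
    intro j
    rcases Nat.mod_two_eq_zero_or_one j with hj | hj
    · exact ⟨⟨j + 1, by omega⟩, Or.inl ⟨hj, rfl⟩⟩
    · exact ⟨⟨j - 1, by omega⟩, Or.inr (by constructor <;> simp <;> omega)⟩
  have hJJ : J ∘ₗ J = -LinearMap.id := b.ext fun j => by
    rw [hb]
    obtain ⟨k, ⟨h, h'⟩ | ⟨h, h'⟩⟩ := hpair j
    · simp [hJeven j k h h', hJodd j k h h']
    · simp [hJeven k j h h', hJodd k j h h']
  have hΩJ : Ω.compl₂ J = g := LinearMap.ext_basis b b fun i j => by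
    rw [hb, hb, LinearMap.compl₂_apply, he]
    obtain ⟨k, ⟨h, h'⟩ | ⟨h, h'⟩⟩ := hpair j
    · rw [hJeven j k h h']
      split_ifs with hij
      · exact hij ▸ hone j k h h'
      · exact hzero i k (by rw [Fin.ext_iff] at hij; omega) (by omega)
    · rw [hJodd k j h h', map_neg]
      split_ifs with hij
      · rw [hΩ, neg_neg, hij, hone k j h h']
      · rw [hzero i k (by omega) (by rw [Fin.ext_iff] at hij; omega), neg_zero]
  exact ⟨J, fun v => LinearMap.congr_fun hJJ v, fun v w => LinearMap.congr_fun₂ hΩJ v w⟩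

end LinearAlgebra

/-- Every strictly pseudo-convex pseudo-Hermitian structure `(M, H, J, θ)`
of dimension `2n+1` determines an oriented sub-Riemannian contact structure, with metric
`g(X,Y) = Ω(X, JY)` (`Ω = dθ|_H`) and with `H` oriented by `J`; in dimension 3 this
inclusion is an equality: every oriented sub-Riemannian contact 3-manifold arises in
this way.  In local coframes in which `g` is the identity and `Ω` is in block-diagonal
normal form with parameters `λ₁, …, λ_n`, the pseudo-Hermitian (CR) case corresponds
exactly to `λ₁ = ⋯ = λ_n = 1`.

`M` is modelled by an open set `U ⊆ ℝ^{2n+1}` with `H = ker θ`; an orientation of `H` is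
modelled by a smooth field `ν` of alternating 2-forms, nowhere vanishing on `H`; the
third part is the pointwise linear-algebra statement on the fibre. -/
theorem statement7 :
    -- (1) a strictly pseudo-convex pseudo-Hermitian structure gives a sub-Riemannian metric
    (∀ (n : ℕ), 0 < n → ∀ (U : Set (E (2 * n + 1))), IsOpen U →
      ∀ (θ : E (2 * n + 1) → Cov (2 * n + 1)) (J : E (2 * n + 1) → (E (2 * n + 1) →L[ℝ] E (2 * n + 1))),
        IsContactForm U θ → SmoothOnD J U →
        (∀ x ∈ U, ∀ v : E (2 * n + 1), θ x v = 0 → θ x (J x v) = 0) →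
        (∀ x ∈ U, ∀ v : E (2 * n + 1), θ x v = 0 → J x (J x v) = -v) →
        -- partial integrability (implied by integrability of the CR structure):
        -- Ω(·, J·) is symmetric on H
        (∀ x ∈ U, ∀ v w : E (2 * n + 1), θ x v = 0 → θ x w = 0 →
          extDer θ x v (J x w) = extDer θ x w (J x v)) →
        -- strict pseudo-convexity: Ω(·, J·) is positive definite on H
        (∀ x ∈ U, ∀ v : E (2 * n + 1), θ x v = 0 → v ≠ 0 → 0 < extDer θ x v (J x v)) →
        -- conclusion: g := Ω(·, J·) is a smooth sub-Riemannian metric on H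
        ∃ g : E (2 * n + 1) → (E (2 * n + 1) →L[ℝ] E (2 * n + 1) →L[ℝ] ℝ),
          SmoothOnD g U ∧
          (∀ x ∈ U, ∀ v w : E (2 * n + 1), θ x v = 0 → θ x w = 0 →
            g x v w = extDer θ x v (J x w)) ∧
          (∀ x ∈ U, ∀ v w : E (2 * n + 1), θ x v = 0 → θ x w = 0 → g x v w = g x w v) ∧
          (∀ x ∈ U, ∀ v : E (2 * n + 1), θ x v = 0 → v ≠ 0 → 0 < g x v v)) ∧
    -- (2) in dimension 3 every oriented sub-Riemannian contact structure arises this way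
    (∀ (U : Set (E 3)), IsOpen U →
      ∀ (θ₀ : E 3 → Cov 3) (g : E 3 → (E 3 →L[ℝ] E 3 →L[ℝ] ℝ))
        (ν : E 3 → (E 3 →L[ℝ] E 3 →L[ℝ] ℝ)),
        IsContactForm U θ₀ → SmoothOnD g U →
        (∀ x ∈ U, ∀ u w : E 3, g x u w = g x w u) →
        (∀ x ∈ U, ∀ v : E 3, θ₀ x v = 0 → v ≠ 0 → 0 < g x v v) →
        -- ν is an orientation of H
        SmoothOnD ν U →
        (∀ x ∈ U, ∀ u w : E 3, ν x u w = - ν x w u) →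
        (∀ x ∈ U, ∃ u w : E 3, θ₀ x u = 0 ∧ θ₀ x w = 0 ∧ ν x u w ≠ 0) →
        ∃ (θ : E 3 → Cov 3) (J : E 3 → (E 3 →L[ℝ] E 3)),
          (∀ x ∈ U, ∀ v : E 3, θ x v = 0 ↔ θ₀ x v = 0) ∧
          IsContactForm U θ ∧ SmoothOnD J U ∧
          -- dθ|_H is positively proportional to the orientation ν
          (∀ x ∈ U, ∀ u w : E 3, θ₀ x u = 0 → θ₀ x w = 0 →
            0 ≤ ν x u w * extDer θ x u w) ∧
          (∀ x ∈ U, ∀ v : E 3, θ₀ x v = 0 → θ₀ x (J x v) = 0) ∧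
          (∀ x ∈ U, ∀ v : E 3, θ₀ x v = 0 → J x (J x v) = -v) ∧
          -- the given metric is recovered as g = Ω(·, J·)
          (∀ x ∈ U, ∀ v w : E 3, θ₀ x v = 0 → θ₀ x w = 0 →
            extDer θ x v (J x w) = g x v w)) ∧
    -- (3) pointwise: the CR case corresponds exactly to λ₁ = ⋯ = λ_n = 1
    (∀ (n : ℕ) (V : Type) (_ : AddCommGroup V) (_ : Module ℝ V) (_ : FiniteDimensional ℝ V),
      Module.finrank ℝ V = 2 * n →
      ∀ (g : V →ₗ[ℝ] V →ₗ[ℝ] ℝ), (∀ u v : V, g u v = g v u) → (∀ v : V, v ≠ 0 → 0 < g v v) →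
      ∀ (Ω : V →ₗ[ℝ] V →ₗ[ℝ] ℝ), (∀ u v : V, Ω u v = - Ω v u) →
        ((∀ v : V, (∀ w : V, Ω v w = 0) → v = 0) →
        ((∃ J : V →ₗ[ℝ] V, (∀ v : V, J (J v) = -v) ∧ ∀ v w : V, Ω v (J w) = g v w) ↔
          ∃ e : Fin (2 * n) → V,
            (∀ i j, g (e i) (e j) = if i = j then 1 else 0) ∧
            Submodule.span ℝ (Set.range e) = ⊤ ∧
            (∀ i : Fin n, Ω (e ⟨2 * (i : ℕ), by omega⟩) (e ⟨2 * (i : ℕ) + 1, by omega⟩) = 1) ∧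
            (∀ i j : Fin (2 * n), (i : ℕ) < (j : ℕ) →
              ¬((j : ℕ) = (i : ℕ) + 1 ∧ (i : ℕ) % 2 = 0) → Ω (e i) (e j) = 0)))) := by
  refine ⟨?_, ?_, ?_⟩
  · intro n _ U hU θ J hθ hJ _ _ hsymm hpos
    obtain ⟨g, hg, hgΩ⟩ := exists_subRiemannian_metric hU hθ.1 hJ
    refine ⟨g, hg, fun x _ v w _ _ => hgΩ x v w, fun x hx v w hv hw => ?_, fun x hx v hv h => ?_⟩
    · rw [hgΩ, hgΩ, hsymm x hx v w hv hw]
    · rw [hgΩ]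
      exact hpos x hx v hv h
  · intro U hU θ₀ g ν hθ₀ hg hgsymm hgpos hν hνanti hνne
    exact exists_pseudoHermitian_of_subRiemannian hU hθ₀ hg hgsymm hgpos hν hνanti hνne
  · intro n V _ _ _ hn g hsymm hpos Ω hΩ _
    constructor
    · rintro ⟨J, hJJ, hΩJ⟩
      obtain ⟨e, he, hspan, h1, h0⟩ := exists_unitary_coframe hn hsymm hpos hΩ hJJ hΩJ
      exact ⟨e, he, hspan, fun i => h1 _ _ (by simp) rfl, h0⟩
    · rintro ⟨e, he, hspan, h1, h0⟩
      refine exists_complexStructure hΩ he hspan (fun i j hi hij => ?_) h0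
      convert h1 ⟨(i : ℕ) / 2, by omega⟩ using 3 <;> congr 1 <;> ext <;> simp <;> omega
end
end

section
/- Let V be a finite-dimensional real vector space. The linear map from the space of trilinear forms T : V × V × V → ℝ that are symmetric in their first two arguments to the space of trilinear forms that are symmetric in their last two arguments, defined by sending T to the trilinear form (x, y, z) ↦ T(x, y, z) + T(x, z, y), is a linear isomorphism. (Equivalently, the composition ⊙²V ⊗ V ↪ V⊗V⊗V → V ⊗ ⊙²V, embedding followed by symmetrisation of the last two factors, is an isomorphism.) -/
/-!
STATEMENT 15: Let `V` be a finite-dimensional real vector space.  The linear map from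
the space of trilinear forms on `V` that are symmetric in their first two arguments to
the space of trilinear forms that are symmetric in their last two arguments, defined by
`T ↦ ((x, y, z) ↦ T x y z + T x z y)`, is a linear isomorphism.
(Equivalently, `⊙²V ⊗ V ↪ V⊗V⊗V → V ⊗ ⊙²V` is an isomorphism: the algebraic fact
underlying the existence and uniqueness of the Levi-Civita connection.)
-/

noncomputable section

/-- Trilinear forms symmetric in the first two arguments. -/
def symFirstTwo (V : Type*) [AddCommGroup V] [Module ℝ V] :
    Submodule ℝ (V →ₗ[ℝ] V →ₗ[ℝ] V →ₗ[ℝ] ℝ) where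
  carrier := {T | ∀ x y z : V, T x y z = T y x z}
  add_mem' := by
    intro a b ha hb x y z
    simp only [LinearMap.add_apply]
    rw [ha x y z, hb x y z]
  zero_mem' := by intro x y z; simp
  smul_mem' := by
    intro c a ha x y z
    simp only [LinearMap.smul_apply, smul_eq_mul]
    rw [ha x y z]

/-- Trilinear forms symmetric in the last two arguments. -/
def symLastTwo (V : Type*) [AddCommGroup V] [Module ℝ V] :
    Submodule ℝ (V →ₗ[ℝ] V →ₗ[ℝ] V →ₗ[ℝ] ℝ) where
  carrier := {T | ∀ x y z : V, T x y z = T x z y}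
  add_mem' := by
    intro a b ha hb x y z
    simp only [LinearMap.add_apply]
    rw [ha x y z, hb x y z]
  zero_mem' := by intro x y z; simp
  smul_mem' := by
    intro c a ha x y z
    simp only [LinearMap.smul_apply, smul_eq_mul]
    rw [ha x y z]

/-- Interchange of the last two arguments of a trilinear form. -/
def flipLastTwo (V : Type*) [AddCommGroup V] [Module ℝ V] :
    (V →ₗ[ℝ] V →ₗ[ℝ] V →ₗ[ℝ] ℝ) →ₗ[ℝ] (V →ₗ[ℝ] V →ₗ[ℝ] V →ₗ[ℝ] ℝ) where
  toFun T := LinearMap.lflip.comp T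
  map_add' _ _ := rfl
  map_smul' _ _ := rfl

@[simp]
theorem flipLastTwo_apply {V : Type*} [AddCommGroup V] [Module ℝ V]
    (T : V →ₗ[ℝ] V →ₗ[ℝ] V →ₗ[ℝ] ℝ) (x y z : V) :
    flipLastTwo V T x y z = T x z y := rfl

/-- Symmetrisation in the last two arguments, restricted to forms symmetric in the first two. -/
def symmetriseLastTwo (V : Type*) [AddCommGroup V] [Module ℝ V] :
    symFirstTwo V →ₗ[ℝ] symLastTwo V :=
  ((LinearMap.id + flipLastTwo V).comp (symFirstTwo V).subtype).codRestrict (symLastTwo V)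
    fun T x y z => by simp [add_comm]

@[simp]
theorem symmetriseLastTwo_apply {V : Type*} [AddCommGroup V] [Module ℝ V]
    (T : symFirstTwo V) (x y z : V) :
    (symmetriseLastTwo V T : V →ₗ[ℝ] V →ₗ[ℝ] V →ₗ[ℝ] ℝ) x y z
      = (T : V →ₗ[ℝ] V →ₗ[ℝ] V →ₗ[ℝ] ℝ) x y z
        + (T : V →ₗ[ℝ] V →ₗ[ℝ] V →ₗ[ℝ] ℝ) x z y := rfl

/-- The Koszul formula `(x, y, z) ↦ (S x y z + S y x z - S z x y) / 2`. -/
def koszulForm {V : Type*} [AddCommGroup V] [Module ℝ V] (S : symLastTwo V) : symFirstTwo V :=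
  ⟨(2⁻¹ : ℝ) • (S.1 + S.1.flip + (-1 : ℝ) • flipLastTwo V S.1.flip), fun x y z => by
    have h := S.2 z x y
    simp only [LinearMap.smul_apply, LinearMap.add_apply,
      LinearMap.flip_apply, flipLastTwo_apply, smul_eq_mul]
    linarith⟩

theorem koszulForm_apply {V : Type*} [AddCommGroup V] [Module ℝ V]
    (S : symLastTwo V) (x y z : V) :
    (koszulForm S : V →ₗ[ℝ] V →ₗ[ℝ] V →ₗ[ℝ] ℝ) x y z
      = 2⁻¹ * (S.1 x y z + S.1 y x z + -1 * S.1 z x y) := rfl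

theorem koszulForm_symmetriseLastTwo {V : Type*} [AddCommGroup V] [Module ℝ V]
    (T : symFirstTwo V) : koszulForm (symmetriseLastTwo V T) = T := by
  ext x y z
  simp only [koszulForm_apply, symmetriseLastTwo_apply]
  linarith [T.2 x y z, T.2 x z y, T.2 y z x]

theorem symmetriseLastTwo_koszulForm {V : Type*} [AddCommGroup V] [Module ℝ V]
    (S : symLastTwo V) : symmetriseLastTwo V (koszulForm S) = S := by
  ext x y z
  simp only [koszulForm_apply, symmetriseLastTwo_apply]
  linarith [S.2 x y z, S.2 y x z, S.2 z x y]

theorem statement15 {V : Type*} [AddCommGroup V] [Module ℝ V] [FiniteDimensional ℝ V] :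
    ∃ Φ : symFirstTwo V ≃ₗ[ℝ] symLastTwo V,
      ∀ (T : symFirstTwo V) (x y z : V),
        (Φ T : V →ₗ[ℝ] V →ₗ[ℝ] V →ₗ[ℝ] ℝ) x y z
          = (T : V →ₗ[ℝ] V →ₗ[ℝ] V →ₗ[ℝ] ℝ) x y z
            + (T : V →ₗ[ℝ] V →ₗ[ℝ] V →ₗ[ℝ] ℝ) x z y :=
  ⟨{ symmetriseLastTwo V with
      invFun := koszulForm
      left_inv := koszulForm_symmetriseLastTwo
      right_inv := symmetriseLastTwo_koszulForm }, symmetriseLastTwo_apply⟩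
end
end

section
/- Let V be a real vector space of dimension 2n+1, let α be a nonzero linear functional on V, and let ω be an alternating bilinear form on V whose restriction to the hyperplane ker α is nondegenerate. Then there exists a unique vector T ∈ V such that α(T) = 1 and ω(T, v) = 0 for all v ∈ V. (This is the pointwise existence and uniqueness of the Reeb field of a contact form.) -/
/-!
STATEMENT 17: Let `V` be a real vector space of dimension `2n+1`, let `α` be a nonzero
linear functional on `V`, and let `ω` be an alternating bilinear form on `V` whose
restriction to the hyperplane `ker α` is nondegenerate.  Then there exists a unique
vector `T ∈ V` such that `α T = 1` and `ω T v = 0` for all `v ∈ V`.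
(Pointwise existence and uniqueness of the Reeb field of a contact form.)
-/

theorem statement17 {n : ℕ} {V : Type*} [AddCommGroup V] [Module ℝ V]
    [FiniteDimensional ℝ V] (hdim : Module.finrank ℝ V = 2 * n + 1)
    (α : V →ₗ[ℝ] ℝ) (hα : α ≠ 0)
    (ω : V →ₗ[ℝ] V →ₗ[ℝ] ℝ) (hωalt : ∀ u v : V, ω u v = - ω v u)
    (hnd : ∀ v : V, α v = 0 → (∀ w : V, α w = 0 → ω v w = 0) → v = 0) :
    ∃! T : V, α T = 1 ∧ ∀ v : V, ω T v = 0 := by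
  obtain ⟨u, hu⟩ : ∃ u, α u = 1 := LinearMap.surjective hα 1
  let B : LinearMap.ker α →ₗ[ℝ] Module.Dual ℝ (LinearMap.ker α) :=
    ω.domRestrict₁₂ (LinearMap.ker α) (LinearMap.ker α)
  have hB_inj : Function.Injective B := by
    rw [← LinearMap.ker_eq_bot, LinearMap.ker_eq_bot']
    intro v hv
    exact Subtype.ext (hnd v v.2 fun w hw => LinearMap.congr_fun hv ⟨w, hw⟩)
  have hB_surj : Function.Surjective B :=
    (LinearMap.injective_iff_surjective_of_finrank_eq_finrank
      Subspace.dual_finrank_eq.symm).1 hB_inj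
  obtain ⟨k, hk⟩ := hB_surj ((ω u).domRestrict (LinearMap.ker α))
  have hk_ker : α k = 0 := k.2
  have hT_one : α (u - k) = 1 := by simp [hu, hk_ker]
  have hT_ker : ∀ w, α w = 0 → ω (u - k) w = 0 := by
    intro w hw
    have h : ω k w = ω u w := LinearMap.congr_fun hk ⟨w, hw⟩
    simp [h]
  have hT_self : ω (u - k) (u - k) = 0 := self_eq_neg.1 (hωalt _ _)
  refine ⟨u - k, ⟨hT_one, fun v => ?_⟩, ?_⟩
  · have h := hT_ker (v - α v • (u - k)) (by rw [map_sub, map_smul, hT_one]; simp)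
    rwa [map_sub, map_smul, hT_self, smul_zero, sub_zero] at h
  · rintro S ⟨hS_one, hS⟩
    refine sub_eq_zero.1 (hnd _ (by rw [map_sub, hS_one, hT_one, sub_self]) fun w hw => ?_)
    rw [map_sub, LinearMap.sub_apply, hS, hT_ker w hw, sub_self]
end
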